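/- arXiv:1908.06026 — 3 statements merged into one kernel-verified Lean document; each statement's English description precedes it below -/
import Mathlib

section
/- Suppose F₀ is a non-constant entire function and there exist two sequences of nonzero complex numbers (λₙ), (μₙ) and two sequences of entire functions (Fₙ), (Gₙ) with F₀ = G₀, satisfying Fₙ(z) = λ_{n+1}·e^{F_{n+1}(z)} and Gₙ(z) = μ_{n+1}·e^{G_{n+1}(z)} for all n ≥ 0 and all z ∈ ℂ. Then λₙ = μₙ and Fₙ = Gₙ for all n. -/
open Complex

lemma tu_log (f : ℂ → ℂ) (hf : Differentiable ℂ f) (h0 : ∀ z, f z ≠ 0) :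
    ∃ g : ℂ → ℂ, Differentiable ℂ g ∧ ∀ z, f z = Complex.exp (g z) := by
  have hd : Differentiable ℂ (deriv f) := fun z => (hf.analyticAt z).deriv.differentiableAt
  have hq : Differentiable ℂ (fun z => deriv f z / f z) := hd.div hf h0
  have hg : ∀ z, HasDerivAt (fun w ↦ Complex.wedgeIntegral 0 w (fun z => deriv f z / f z))
      (deriv f z / f z) z := by
    intro z
    have h1 : DifferentiableOn ℂ (fun z => deriv f z / f z) (Metric.ball 0 (‖z‖ + 1)) :=
      hq.differentiableOn
    exact h1.isConservativeOn.hasDerivAt_wedgeIntegral h1.continuousOn (by simp)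
  set g := (fun w ↦ Complex.wedgeIntegral 0 w (fun z => deriv f z / f z)) with hgdef
  have hk : ∀ z, HasDerivAt (fun z => f z * Complex.exp (- g z)) 0 z := by
    intro z
    have := (hf z).hasDerivAt.mul ((hg z).neg.cexp)
    refine this.congr_deriv ?_
    have h0z := h0 z
    simp only [Pi.neg_apply]
    have e : f z * (Complex.exp (-g z) * -(deriv f z / f z)) = - (deriv f z * Complex.exp (-g z)) := by
      field_simp
    rw [e]
    ring
  have hc : ∀ z, f z * Complex.exp (- g z) = f 0 * Complex.exp (- g 0) := fun z =>
    is_const_of_deriv_eq_zero (fun z => (hk z).differentiableAt) (fun z => (hk z).deriv) z 0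
  refine ⟨fun z => g z + Complex.log (f 0 * Complex.exp (- g 0)),
    fun z => ((hg z).differentiableAt).add_const _, fun z => ?_⟩
  rw [Complex.exp_add, Complex.exp_log (mul_ne_zero (h0 0) (Complex.exp_ne_zero _)), ← hc z,
    Complex.exp_neg]
  have := Complex.exp_ne_zero (g z)
  field_simp

lemma tu_cos (f : ℂ → ℂ) (hf : Differentiable ℂ f) (h1 : ∀ z, f z ≠ 1) (h2 : ∀ z, f z ≠ -1) :
    ∃ g : ℂ → ℂ, Differentiable ℂ g ∧ ∀ z, f z = Complex.cos (Real.pi * g z) := by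
  obtain ⟨u, hu, hu'⟩ := tu_log (fun z => 1 - f z ^ 2) (by fun_prop) (by
    intro z h
    have : (f z - 1) * (f z + 1) = 0 := by linear_combination -h
    rcases mul_eq_zero.1 this with h | h
    · exact h1 z (by linear_combination h)
    · exact h2 z (by linear_combination h))
  have hs : ∀ z, Complex.exp (u z / 2) ^ 2 = 1 - f z ^ 2 := by
    intro z
    rw [hu' z, ← Complex.exp_nat_mul]
    congr 1
    push_cast; ring
  have hprod : ∀ z, (f z + I * Complex.exp (u z / 2)) * (f z - I * Complex.exp (u z / 2)) = 1 := by
    intro z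
    have := hs z
    linear_combination this - (Complex.exp (u z / 2)) ^ 2 * I_sq
  obtain ⟨v, hv, hv'⟩ := tu_log (fun z => f z + I * Complex.exp (u z / 2)) (by fun_prop) (by
    intro z h
    have := hprod z
    rw [h] at this
    simp at this)
  have hpi : (Real.pi : ℂ) ≠ 0 := by exact_mod_cast Real.pi_ne_zero
  refine ⟨fun z => v z * (-I) / Real.pi, by fun_prop, fun z => ?_⟩
  have e1 : (Real.pi : ℂ) * (v z * (-I) / Real.pi) = v z * (-I) := by field_simp
  simp only [e1]
  rw [Complex.cos]
  have e2 : v z * -I * I = v z := by linear_combination - v z * I_sq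
  have e3 : -(v z * -I) * I = - v z := by linear_combination v z * I_sq
  have e4 : Complex.exp (- v z) = f z - I * Complex.exp (u z / 2) := by
    rw [Complex.exp_neg, ← hv' z]
    exact inv_eq_of_mul_eq_one_right (hprod z)
  rw [e2, e3, e4, ← hv' z]
  ring

lemma tu_bloch (f : ℂ → ℂ) (hf : Differentiable ℂ f) (a : ℂ) (ha : deriv f a ≠ 0) (M : ℝ) :
    ∃ w : ℂ, Metric.ball w M ⊆ Set.range f := by
  have hd : Differentiable ℂ (deriv f) := fun z => (hf.analyticAt z).deriv.differentiableAt
  have hapos : 0 < ‖deriv f a‖ := norm_pos_iff.2 ha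
  obtain ⟨R, hR, hRM⟩ : ∃ R : ℝ, 0 < R ∧ 48 * M ≤ R * ‖deriv f a‖ := by
    refine ⟨(48 * |M| + 1) / ‖deriv f a‖, by positivity, ?_⟩
    rw [div_mul_cancel₀ _ hapos.ne']
    linarith [le_abs_self M]
  obtain ⟨p, hp, hmax⟩ := (isCompact_closedBall a R).exists_isMaxOn
    ⟨a, Metric.mem_closedBall_self hR.le⟩
    (f := fun z => ‖deriv f z‖ * (R - dist z a))
    (by have := hd.continuous; fun_prop)
  have hmax' : ∀ z ∈ Metric.closedBall a R,
    ‖deriv f z‖ * (R - dist z a) ≤ ‖deriv f p‖ * (R - dist p a) := fun z hz => hmax hz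
  have hpa := hmax' a (Metric.mem_closedBall_self hR.le)
  simp only [dist_self, sub_zero] at hpa
  have hpos : 0 < ‖deriv f p‖ * (R - dist p a) := lt_of_lt_of_le (by positivity) hpa
  have hpR : 0 ≤ R - dist p a := by
    have := Metric.mem_closedBall.1 hp; linarith
  have hD : 0 < ‖deriv f p‖ := pos_of_mul_pos_left hpos hpR
  have ht0 : 0 < R - dist p a := pos_of_mul_pos_right hpos hD.le
  obtain ⟨t, ht⟩ : ∃ t, t = (R - dist p a) / 2 := ⟨_, rfl⟩
  have htp : 0 < t := by linarith
  set D := ‖deriv f p‖ with hDdef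
  have hb : ∀ z ∈ Metric.ball p t, ‖deriv f z‖ ≤ 2 * D := by
    intro z hz
    have hz := Metric.mem_ball.1 hz
    have h3 : dist z a ≤ dist z p + dist p a := dist_triangle _ _ _
    have h4 := hmax' z (Metric.mem_closedBall.2 (by linarith))
    have h5 : t ≤ R - dist z a := by linarith
    have h6 : ‖deriv f z‖ * t ≤ 2 * D * t := by
      calc _ ≤ ‖deriv f z‖ * (R - dist z a) := by gcongr
        _ ≤ _ := h4
        _ = _ := by rw [ht]; ring
    exact le_of_mul_le_mul_right h6 htp
  have hsch : ∀ z ∈ Metric.ball p t, ‖deriv f z - deriv f p‖ ≤ 3 * D / t * dist z p := by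
    intro z hz
    rw [← dist_eq_norm]
    refine Complex.dist_le_div_mul_dist_of_mapsTo_ball hd.differentiableOn ?_ hz
    intro y hy
    rw [Metric.mem_closedBall, dist_eq_norm]
    have := norm_sub_le (deriv f y) (deriv f p)
    linarith [hb y hy]
  refine ⟨f p, ?_⟩
  have key : ∀ z ∈ Metric.sphere p (t / 6), D * t / 12 ≤ ‖f z - f p‖ := by
    intro z hz
    have hz : dist z p = t / 6 := hz
    have hder : ∀ y, HasDerivAt (fun y => f y - deriv f p * y) (deriv f y - deriv f p) y := by
      intro y
      have := (hf y).hasDerivAt.fun_sub ((hasDerivAt_id' y).const_mul (deriv f p))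
      rwa [mul_one] at this
    have := (convex_closedBall p (t / 6)).norm_image_sub_le_of_norm_deriv_le (𝕜 := ℂ)
      (f := fun y => f y - deriv f p * y) (C := D / 2) (x := p) (y := z)
      (fun y _ => (hder y).differentiableAt)
      (fun y hy => by
        rw [(hder y).deriv]
        have hy := Metric.mem_closedBall.1 hy
        refine (hsch y (Metric.mem_ball.2 (by linarith))).trans ?_
        calc 3 * D / t * dist y p ≤ 3 * D / t * (t / 6) := by gcongr
          _ = D / 2 := by field_simp; norm_num)
      (Metric.mem_closedBall_self (by positivity)) (Metric.mem_closedBall.2 hz.le)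
    rw [← dist_eq_norm z p, hz] at this
    have e : f z - f p = (f z - deriv f p * z - (f p - deriv f p * p)) + deriv f p * (z - p) := by
      ring
    have h7 : ‖deriv f p * (z - p)‖ = D * (t / 6) := by
      rw [norm_mul, ← dist_eq_norm z p, hz]
    have h8 : ‖deriv f p * (z - p)‖ ≤ ‖f z - f p‖
        + ‖f z - deriv f p * z - (f p - deriv f p * p)‖ := by
      have := norm_sub_le (f z - f p) (f z - deriv f p * z - (f p - deriv f p * p))
      have e9 : f z - f p - (f z - deriv f p * z - (f p - deriv f p * p)) = deriv f p * (z - p) := by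
        ring
      rwa [e9] at this
    linarith
  have hfr : ∃ᶠ z in nhds p, f z ≠ f p := by
    intro h
    simp only [ne_eq, not_not] at h
    have h' : f =ᶠ[nhds p] fun _ => f p := h
    have := h'.deriv_eq
    simp at this
    rw [hDdef, this] at hD
    simp at hD
  have := (hf.diffContOnCl (s := Metric.ball p (t / 6))).ball_subset_image_closedBall
    (by positivity) key hfr
  refine (Metric.ball_subset_ball ?_).trans (this.trans (Set.image_subset_range _ _))
  have : D * (R - dist p a) = 2 * (D * t) := by rw [ht]; ring
  linarith

lemma tu_cosint (x : ℂ) (n : ℤ) :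
    Complex.cos (x + n * Real.pi) = (-1) ^ n * Complex.cos x := by
  rcases Int.even_or_odd' n with ⟨k, rfl | rfl⟩
  · rw [(even_two_mul k).neg_one_zpow, one_mul, ← Complex.cos_add_int_mul_two_pi x k]
    congr 1; push_cast; ring
  · rw [(odd_two_mul_add_one k).neg_one_zpow, neg_one_mul, ← Complex.cos_add_pi,
      ← Complex.cos_add_int_mul_two_pi (x + Real.pi) k]
    congr 1; push_cast; ring

lemma tu_grid (w : ℂ) : ∃ v : ℂ, dist v w < 3 ∧ ∃ n : ℤ, Complex.cos (Real.pi * v) = n := by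
  have hpi := Real.pi_gt_three
  set y := |w.im| with hy
  have hy0 : 0 ≤ y := abs_nonneg _
  have hg : Real.cosh (Real.pi * y) + 1 ≤ Real.cosh (Real.pi * (y + 1)) := by
    rw [mul_add, mul_one, Real.cosh_add]
    have h1 := Real.one_le_cosh (Real.pi * y)
    have h2 : 2 ≤ Real.cosh Real.pi := by
      rw [Real.cosh_eq]
      have := Real.add_one_le_exp Real.pi
      have := Real.exp_pos (-Real.pi)
      linarith
    have h3 : 0 ≤ Real.sinh (Real.pi * y) := Real.sinh_nonneg_iff.2 (by positivity)
    have h4 : 0 ≤ Real.sinh Real.pi := Real.sinh_nonneg_iff.2 (by positivity)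
    nlinarith [mul_nonneg h3 h4]
  have hc : Continuous (fun s : ℝ => Real.cosh (Real.pi * s)) := by
    have := Real.continuous_cosh; fun_prop
  obtain ⟨s, hs, hs'⟩ := intermediate_value_Icc (show y ≤ y + 1 by linarith) hc.continuousOn
    (show (⌈Real.cosh (Real.pi * y)⌉ : ℝ) ∈ Set.Icc (Real.cosh (Real.pi * y))
      (Real.cosh (Real.pi * (y + 1))) from
      ⟨Int.le_ceil _, (Int.ceil_lt_add_one _).le.trans hg⟩)
  simp only at hs'
  obtain ⟨s', hs1, hs2⟩ : ∃ s' : ℝ, |s' - w.im| ≤ 1 ∧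
      Real.cosh (Real.pi * s') = ⌈Real.cosh (Real.pi * y)⌉ := by
    rcases le_total 0 w.im with h | h
    · rw [abs_of_nonneg h] at hy
      exact ⟨s, by rw [abs_le]; constructor <;> linarith [hs.1, hs.2], hs'⟩
    · rw [abs_of_nonpos h] at hy
      refine ⟨-s, by rw [abs_le]; constructor <;> linarith [hs.1, hs.2], ?_⟩
      rw [mul_neg, Real.cosh_neg]; exact hs'
  set k := ⌈Real.cosh (Real.pi * y)⌉
  set m := ⌊w.re⌋ with hm
  refine ⟨m + s' * I, ?_, (m.negOnePow : ℤ) * k, ?_⟩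
  · rw [dist_eq_norm]
    refine (Complex.norm_le_abs_re_add_abs_im _).trans_lt ?_
    have : |(m : ℝ) - w.re| ≤ 1 := by
      rw [abs_le]; constructor <;> linarith [Int.floor_le w.re, Int.lt_floor_add_one w.re]
    simp
    linarith
  · have e : (Real.pi : ℂ) * (m + s' * I) = ((Real.pi * s' : ℝ) : ℂ) * I + m * Real.pi := by
      push_cast; ring
    rw [e, tu_cosint, Complex.cos_mul_I, ← Complex.ofReal_cosh, hs2]
    rcases Int.even_or_odd m with h | h
    · simp [Int.negOnePow_even m h, h.neg_one_zpow]
    · simp [Int.negOnePow_odd m h, h.neg_one_zpow]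

lemma tu_picard (f : ℂ → ℂ) (hf : Differentiable ℂ f) (h1 : ∀ z, f z ≠ 1) (h2 : ∀ z, f z ≠ -1) :
    ∃ c, ∀ z, f z = c := by
  obtain ⟨g, hg, hfg⟩ := tu_cos f hf h1 h2
  have hgi : ∀ (n : ℤ) z, g z ≠ n := by
    intro n z h
    have e := hfg z
    rw [h, mul_comm] at e
    have e2 := tu_cosint 0 n
    rw [zero_add, Complex.cos_zero, mul_one] at e2
    rw [e2] at e
    rcases Int.even_or_odd n with h | h
    · exact h1 z (by rw [e, h.neg_one_zpow])
    · exact h2 z (by rw [e, h.neg_one_zpow])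
  obtain ⟨k, hk, hgk⟩ := tu_cos g hg (by simpa using hgi 1) (by simpa using hgi (-1))
  have hk0 : ∀ a, deriv k a = 0 := by
    intro a
    by_contra ha
    obtain ⟨w, hw⟩ := tu_bloch k hk a ha 3
    obtain ⟨v, hv, n, hn⟩ := tu_grid w
    obtain ⟨z, rfl⟩ := hw (Metric.mem_ball.2 hv)
    exact hgi n z (by rw [hgk, hn])
  refine ⟨f 0, fun z => ?_⟩
  rw [hfg, hfg, hgk, hgk 0, is_const_of_deriv_eq_zero hk hk0 z 0]

/-- uniqueness of the exponential tower for a non-constant entire function. -/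
theorem tower_unique
    (F G : ℕ → ℂ → ℂ) (l m : ℕ → ℂ)
    (hF : ∀ n, Differentiable ℂ (F n)) (hG : ∀ n, Differentiable ℂ (G n))
    (hl : ∀ n, l n ≠ 0) (hm : ∀ n, m n ≠ 0)
    (h0 : F 0 = G 0)
    (hnc : ¬ ∃ c : ℂ, ∀ z : ℂ, F 0 z = c)
    (hFt : ∀ n z, F n z = l (n + 1) * Complex.exp (F (n + 1) z))
    (hGt : ∀ n z, G n z = m (n + 1) * Complex.exp (G (n + 1) z)) :
    (∀ n, l (n + 1) = m (n + 1)) ∧ (∀ n, F n = G n) := by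
  have hF0 : ∀ n z, F n z ≠ 0 := fun n z => by
    rw [hFt]; exact mul_ne_zero (hl _) (Complex.exp_ne_zero _)
  have hG0 : ∀ n z, G n z ≠ 0 := fun n z => by
    rw [hGt]; exact mul_ne_zero (hm _) (Complex.exp_ne_zero _)
  have hncn : ∀ n, ¬ ∃ c : ℂ, ∀ z : ℂ, F n z = c := by
    intro n
    induction n with
    | zero => exact hnc
    | succ n ih =>
      rintro ⟨c, hc⟩
      exact ih ⟨l (n + 1) * Complex.exp c, fun z => by rw [hFt, hc]⟩
  have step : ∀ n, F n = G n → F (n + 1) = G (n + 1) := by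
    intro n h
    have hd : ∀ z, deriv (fun z => F (n + 1) z - G (n + 1) z) z = 0 := by
      intro z
      have a1 := ((hF (n + 1) z).hasDerivAt.cexp).const_mul (l (n + 1))
      have a2 := ((hG (n + 1) z).hasDerivAt.cexp).const_mul (m (n + 1))
      have e1 : (fun z => l (n + 1) * Complex.exp (F (n + 1) z)) = F n :=
        funext fun z => (hFt n z).symm
      have e2 : (fun z => m (n + 1) * Complex.exp (G (n + 1) z)) = F n := by
        rw [h]; exact funext fun z => (hGt n z).symm
      rw [e1, ← mul_assoc, ← hFt] at a1
      rw [e2, ← mul_assoc, ← hGt, ← h] at a2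
      have := mul_left_cancel₀ (hF0 n z) (a1.unique a2)
      rw [deriv_fun_sub (hF _ z) (hG _ z), this, sub_self]
    have hc : ∀ z, F (n + 1) z - G (n + 1) z = F (n + 1) 0 - G (n + 1) 0 := fun z =>
      is_const_of_deriv_eq_zero ((hF _).sub (hG _)) hd z 0
    set c := F (n + 1) 0 - G (n + 1) 0
    by_cases hc0 : c = 0
    · funext z
      exact sub_eq_zero.1 ((hc z).trans hc0)
    · exfalso
      obtain ⟨d, hd⟩ := tu_picard (fun z => 2 * F (n + 1) z / c - 1)
        (by have := hF (n + 1); fun_prop)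
        (by
          intro z hz
          apply hG0 (n + 1) z
          field_simp at hz
          linear_combination hz / 2 - hc z)
        (by
          intro z hz
          apply hF0 (n + 1) z
          field_simp at hz
          linear_combination hz / 2)
      refine hncn (n + 1) ⟨(d + 1) * c / 2, fun z => ?_⟩
      rw [← hd z]
      field_simp
      ring
  have hall : ∀ n, F n = G n := by
    intro n
    induction n with
    | zero => exact h0
    | succ n ih => exact step n ih
  refine ⟨fun n => ?_, hall⟩
  have h1 := hFt n 0
  rw [hall n, hGt n 0, hall (n + 1)] at h1
  exact (mul_right_cancel₀ (Complex.exp_ne_zero _) h1).symm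
end

section
/- Let F₀ be a non-constant entire function, n ≥ 0, and suppose Fₙ, F_{n+1}, F_{n+2}, Gₙ, G_{n+1}, G_{n+2} are entire functions with Fₙ = Gₙ, and there exist nonzero λ_{n+1}, λ_{n+2}, μ_{n+1}, μ_{n+2} ∈ ℂ such that F_k = λ_{k+1}·e^{F_{k+1}} and G_k = μ_{k+1}·e^{G_{k+1}} for k = n, n+1, and all of F_n, F_{n+1}, F_{n+2}, G_{n+1}, G_{n+2} are non-constant. Then λ_{n+1} = μ_{n+1} and F_{n+1} = G_{n+1}. -/
open Complex

lemma aux_entire_log (f : ℂ → ℂ) (hf : Differentiable ℂ f) (h0 : ∀ z, f z ≠ 0) :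
    ∃ L : ℂ → ℂ, Differentiable ℂ L ∧ ∀ z, f z = Complex.exp (L z) := by
  have hd : Differentiable ℂ (fun z => deriv f z / f z) :=
    (hf.deriv).div hf h0
  obtain ⟨L, hL0, hL⟩ := hd.isExactOn_univ.with_val_at 0 (Complex.log (f 0))
  have hL' : ∀ z, HasDerivAt L (deriv f z / f z) z := fun z => hL z (Set.mem_univ z)
  refine ⟨L, fun z => (hL' z).differentiableAt, fun z => ?_⟩
  have key : ∀ z, HasDerivAt (fun z => f z * Complex.exp (-L z)) 0 z := by
    intro z
    have h := (hf z).hasDerivAt.mul ((hL' z).neg.cexp)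
    have e : deriv f z * Complex.exp (-L z) +
        f z * (Complex.exp (-L z) * -(deriv f z / f z)) = 0 := by
      have := h0 z
      field_simp
      ring
    exact e ▸ h
  have hc := is_const_of_deriv_eq_zero (fun z => (key z).differentiableAt)
    (fun z => (key z).deriv) z 0
  simp only [hL0] at hc
  rw [Complex.exp_neg, Complex.exp_neg, Complex.exp_log (h0 0), mul_inv_cancel₀ (h0 0)] at hc
  field_simp at hc
  exact hc

lemma aux_entire_sqrt (f : ℂ → ℂ) (hf : Differentiable ℂ f) (h0 : ∀ z, f z ≠ 0) :
    ∃ u : ℂ → ℂ, Differentiable ℂ u ∧ ∀ z, u z ^ 2 = f z := by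
  obtain ⟨L, hL, h⟩ := aux_entire_log f hf h0
  refine ⟨fun z => Complex.exp (L z / 2), by fun_prop, fun z => ?_⟩
  rw [h, ← Complex.exp_nat_mul]
  congr 1
  push_cast
  ring

lemma aux_bloch (g : ℂ → ℂ) (hg : Differentiable ℂ g) (hnc : ¬ ∃ c, ∀ z, g z = c) :
    ∃ w, Metric.ball w 2 ⊆ Set.range g := by
  have hg' : Differentiable ℂ (deriv g) := hg.deriv
  obtain ⟨a, ha⟩ : ∃ a, deriv g a ≠ 0 := by
    by_contra! h
    exact hnc ⟨g 0, fun z => is_const_of_deriv_eq_zero hg h z 0⟩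
  have ha' : 0 < ‖deriv g a‖ := norm_pos_iff.2 ha
  set r : ℝ := 96 / ‖deriv g a‖ with hr
  have hr0 : 0 < r := by positivity
  obtain ⟨p, hp, hmax⟩ := (isCompact_closedBall a r).exists_isMaxOn
    ⟨a, Metric.mem_closedBall_self hr0.le⟩
    (f := fun z => (r - ‖z - a‖) * ‖deriv g z‖)
    (by have := hg'.continuous; fun_prop)
  have hmax' : ∀ z, ‖z - a‖ ≤ r →
      (r - ‖z - a‖) * ‖deriv g z‖ ≤ (r - ‖p - a‖) * ‖deriv g p‖ := fun z hz =>
    hmax (by simpa [dist_eq_norm] using hz)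
  have h1 : 96 ≤ (r - ‖p - a‖) * ‖deriv g p‖ := by
    have := hmax' a (by simpa using hr0.le)
    have h2 : r * ‖deriv g a‖ = 96 := by rw [hr]; field_simp
    simpa [h2] using this
  have hpr : ‖p - a‖ ≤ r := by simpa [dist_eq_norm] using hp
  set D : ℝ := ‖deriv g p‖ with hD
  obtain ⟨ρ, hρ⟩ : ∃ ρ : ℝ, ρ = (r - ‖p - a‖) / 2 := ⟨_, rfl⟩
  have h1' : 48 ≤ ρ * D := by rw [hρ]; linarith
  have hD0 : 0 < D := by
    rcases (norm_nonneg (deriv g p)).lt_or_eq with h | h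
    · exact h
    · rw [← hD] at h; rw [← h] at h1'; norm_num at h1'
  have hρ0 : 0 < ρ := by
    by_contra! h
    nlinarith
  have hbd : ∀ z, ‖z - p‖ < ρ → ‖deriv g z‖ ≤ 2 * D := by
    intro z hz
    have e : ‖z - a‖ ≤ ‖z - p‖ + ‖p - a‖ := by
      have := norm_add_le (z - p) (p - a); simpa using this
    have := hmax' z (by linarith)
    have h3 : ρ * ‖deriv g z‖ ≤ (r - ‖z - a‖) * ‖deriv g z‖ :=
      mul_le_mul_of_nonneg_right (by linarith) (norm_nonneg _)
    have h4 : (r - ‖p - a‖) * D = ρ * (2 * D) := by rw [hρ]; ring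
    exact le_of_mul_le_mul_left (by linarith) hρ0
  have hsch : ∀ z, ‖z - p‖ ≤ ρ / 6 → ‖deriv g z - deriv g p‖ ≤ D / 2 := by
    intro z hz
    have := Complex.dist_le_div_mul_dist_of_mapsTo_ball (f := deriv g) (c := p) (R₁ := ρ)
      (R₂ := 3 * D) (z := z) hg'.differentiableOn (by
        intro y hy
        rw [Metric.mem_ball, dist_eq_norm] at hy
        rw [Metric.mem_closedBall, dist_eq_norm]
        have := norm_sub_le (deriv g y) (deriv g p)
        have := hbd y hy
        linarith) (by rw [Metric.mem_ball, dist_eq_norm]; linarith)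
    rw [dist_eq_norm, dist_eq_norm] at this
    refine this.trans ?_
    calc 3 * D / ρ * ‖z - p‖ ≤ 3 * D / ρ * (ρ / 6) := by gcongr
      _ = D / 2 := by field_simp; norm_num
  have hlow : ∀ z, ‖z - p‖ ≤ ρ / 6 → D / 2 * ‖z - p‖ ≤ ‖g z - g p‖ := by
    intro z hz
    have hder : ∀ y, HasDerivAt (fun y => g y - deriv g p * y) (deriv g y - deriv g p) y := by
      intro y
      have h := (hg y).hasDerivAt.sub ((hasDerivAt_id y).const_mul (deriv g p))
      rw [mul_one] at h
      exact h
    have := Convex.norm_image_sub_le_of_norm_hasDerivWithin_le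
      (s := Metric.closedBall p (ρ / 6)) (C := D / 2) (x := p) (y := z)
      (fun y _ => (hder y).hasDerivWithinAt)
      (fun y hy => hsch y (by simpa [dist_eq_norm] using hy)) (convex_closedBall _ _)
      (Metric.mem_closedBall_self (by positivity)) (by simpa [dist_eq_norm] using hz)
    have e : deriv g p * (z - p) = (g z - g p) -
      ((g z - deriv g p * z) - (g p - deriv g p * p)) := by ring
    have e2 : D * ‖z - p‖ = ‖deriv g p * (z - p)‖ := by rw [norm_mul]
    have e3 := norm_sub_le (g z - g p) ((g z - deriv g p * z) - (g p - deriv g p * p))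
    rw [← e, ← e2] at e3
    linarith
  have himg := DiffContOnCl.ball_subset_image_closedBall (f := g) (z₀ := p) (r := ρ / 6)
    (ε := D / 2 * (ρ / 6)) hg.diffContOnCl (by positivity) (by
      intro z hz
      rw [mem_sphere_iff_norm] at hz
      have := hlow z hz.le
      rwa [hz] at this) (by
      have : ∀ᶠ z in nhdsWithin p {p}ᶜ, g z ≠ g p := by
        have hb : ∀ᶠ z in nhdsWithin p {p}ᶜ, z ∈ Metric.closedBall p (ρ / 6) :=
          nhdsWithin_le_nhds (Metric.closedBall_mem_nhds p (by positivity))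
        filter_upwards [hb, self_mem_nhdsWithin] with z hz hne heq
        have h5 := hlow z (by simpa [dist_eq_norm] using hz)
        have h6 : 0 < ‖z - p‖ := norm_pos_iff.2 (sub_ne_zero.2 hne)
        rw [heq, sub_self, norm_zero] at h5
        nlinarith
      exact this.frequently.filter_mono nhdsWithin_le_nhds)
  refine ⟨g p, fun w hw => ?_⟩
  obtain ⟨z, -, hz⟩ := himg (Metric.ball_subset_ball (by nlinarith) hw)
  exact ⟨z, hz⟩

lemma aux_cosh_nonneg (x : ℝ) (hx : 0 ≤ x) :
    ∃ (t : ℝ) (n : ℤ), |t - x| ≤ 2 ∧ Real.cosh t = 2 * n - 1 := by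
  have h2 : (3 : ℝ) ≤ Real.cosh 2 := by
    have e1 : (1 : ℝ) ≤ Real.sinh 1 := Real.self_le_sinh_iff.2 zero_le_one
    have e2 := Real.cosh_two_mul 1
    have e3 := Real.cosh_sq 1
    rw [mul_one] at e2
    nlinarith
  have h1 := Real.one_le_cosh x
  have h3 : Real.cosh x + 2 ≤ Real.cosh (x + 2) := by
    rw [Real.cosh_add]
    have := mul_nonneg (Real.sinh_nonneg_iff.2 hx) (Real.sinh_nonneg_iff.2 (zero_le_two))
    nlinarith
  set n : ℤ := ⌈(Real.cosh x + 1) / 2⌉ with hn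
  have ha : (Real.cosh x + 1) / 2 ≤ n := Int.le_ceil _
  have hb : (n : ℝ) < (Real.cosh x + 1) / 2 + 1 := Int.ceil_lt_add_one _
  obtain ⟨t, ht, hc⟩ := intermediate_value_Icc (show x ≤ x + 2 by linarith)
    (Real.continuous_cosh.continuousOn)
    (show (2 * n - 1 : ℝ) ∈ _ from ⟨by linarith, by linarith⟩)
  exact ⟨t, n, by rw [abs_le]; constructor <;> linarith [ht.1, ht.2], hc⟩

lemma aux_cosh (x : ℝ) : ∃ (t : ℝ) (n : ℤ), |t - x| ≤ 2 ∧ Real.cosh t = 2 * n - 1 := by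
  rcases le_total 0 x with h | h
  · exact aux_cosh_nonneg x h
  · obtain ⟨t, n, h1, h2⟩ := aux_cosh_nonneg (-x) (by linarith)
    refine ⟨-t, n, ?_, by rwa [Real.cosh_neg]⟩
    rw [← abs_neg]
    convert h1 using 2
    ring

lemma aux_cover (w : ℂ) : ∃ v ∈ Metric.ball w 2, ∃ k : ℤ, Complex.cosh v ^ 2 = k := by
  obtain ⟨t, n, ht, hn⟩ := aux_cosh (2 * w.re)
  set m : ℤ := round (2 * w.im / Real.pi) with hm
  have hm' : |2 * w.im / Real.pi - m| ≤ 1 / 2 := abs_sub_round _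
  have hpi := Real.pi_pos
  have hpi4 := Real.pi_lt_four
  refine ⟨⟨t / 2, m * Real.pi / 2⟩, ?_, ?_⟩
  · rw [Metric.mem_ball, dist_eq_norm]
    refine (Complex.norm_le_abs_re_add_abs_im _).trans_lt ?_
    simp only [Complex.sub_re, Complex.sub_im]
    have h1 : |t / 2 - w.re| ≤ 1 := by
      rw [abs_le] at ht ⊢
      constructor <;> linarith [ht.1, ht.2]
    have h2 : |m * Real.pi / 2 - w.im| < 1 := by
      have : m * Real.pi / 2 - w.im = -(Real.pi / 2) * (2 * w.im / Real.pi - m) := by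
        field_simp; ring
      rw [this, abs_mul, abs_neg, abs_of_pos (by positivity)]
      nlinarith
    linarith
  · have h2v : Complex.cosh (2 * (⟨t / 2, m * Real.pi / 2⟩ : ℂ)) = (-1) ^ m * (2 * n - 1) := by
      have : (2 * (⟨t / 2, m * Real.pi / 2⟩ : ℂ)) = (t : ℂ) + ((m * Real.pi : ℝ) : ℂ) * Complex.I := by
        apply Complex.ext <;> simp <;> ring
      rw [this, Complex.cosh_add, Complex.cosh_mul_I, Complex.sinh_mul_I, ← Complex.ofReal_cosh, hn,
        ← Complex.ofReal_cos, ← Complex.ofReal_sin, Real.sin_int_mul_pi, Real.cos_int_mul_pi]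
      push_cast
      ring
    rw [Complex.cosh_two_mul, Complex.sinh_sq] at h2v
    rcases Int.even_or_odd m with he | ho
    · rw [he.neg_one_zpow] at h2v
      exact ⟨n, by linear_combination h2v / 2⟩
    · rw [ho.neg_one_zpow] at h2v
      exact ⟨1 - n, by push_cast; linear_combination h2v / 2⟩

lemma aux_picard (A : ℂ → ℂ) (hA : Differentiable ℂ A) (hk : ∀ z, ∀ k : ℤ, A z ≠ k) :
    ∃ c, ∀ z, A z = c := by
  obtain ⟨u, hu, hu2⟩ := aux_entire_sqrt A hA (fun z => by simpa using hk z 0)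
  obtain ⟨v, hv, hv2⟩ := aux_entire_sqrt (fun z => A z - 1) (by fun_prop)
    (fun z => sub_ne_zero.2 (by simpa using hk z 1))
  have huv : ∀ z, (u z - v z) * (u z + v z) = 1 := fun z => by
    linear_combination hu2 z - hv2 z
  have hne : ∀ z, u z + v z ≠ 0 := fun z h => by
    have := huv z
    simp [h] at this
  obtain ⟨h, hh, he⟩ := aux_entire_log (fun z => u z + v z) (by fun_prop) hne
  have hcosh : ∀ z, A z = Complex.cosh (h z) ^ 2 := by
    intro z
    have h1 : Complex.exp (-h z) = u z - v z := by
      rw [Complex.exp_neg, ← he z]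
      exact (eq_inv_of_mul_eq_one_left (huv z)).symm
    have h2 : Complex.cosh (h z) = u z := by
      rw [Complex.cosh, h1, ← he z]
      ring
    rw [h2, hu2]
  by_cases hc : ∃ c, ∀ z, h z = c
  · obtain ⟨c, hc⟩ := hc
    exact ⟨Complex.cosh c ^ 2, fun z => by rw [hcosh, hc]⟩
  · exfalso
    obtain ⟨w, hw⟩ := aux_bloch h hh hc
    obtain ⟨p, hp, k, hpk⟩ := aux_cover w
    obtain ⟨z, hz⟩ := hw hp
    exact hk z k (by rw [hcosh, hz, hpk])

/-- the inductive step in the uniqueness argument for exponential towers. -/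
theorem tower_unique_step
    (Fn Fn1 Fn2 Gn Gn1 Gn2 : ℂ → ℂ) (l1 l2 m1 m2 : ℂ)
    (hFn : Differentiable ℂ Fn) (hFn1 : Differentiable ℂ Fn1) (hFn2 : Differentiable ℂ Fn2)
    (hGn : Differentiable ℂ Gn) (hGn1 : Differentiable ℂ Gn1) (hGn2 : Differentiable ℂ Gn2)
    (hl1 : l1 ≠ 0) (hl2 : l2 ≠ 0) (hm1 : m1 ≠ 0) (hm2 : m2 ≠ 0)
    (heq : Fn = Gn)
    (hF1 : ∀ z, Fn z = l1 * Complex.exp (Fn1 z))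
    (hF2 : ∀ z, Fn1 z = l2 * Complex.exp (Fn2 z))
    (hG1 : ∀ z, Gn z = m1 * Complex.exp (Gn1 z))
    (hG2 : ∀ z, Gn1 z = m2 * Complex.exp (Gn2 z))
    (hncFn : ¬ ∃ c : ℂ, ∀ z, Fn z = c)
    (hncFn1 : ¬ ∃ c : ℂ, ∀ z, Fn1 z = c)
    (hncFn2 : ¬ ∃ c : ℂ, ∀ z, Fn2 z = c)
    (hncGn1 : ¬ ∃ c : ℂ, ∀ z, Gn1 z = c)
    (hncGn2 : ¬ ∃ c : ℂ, ∀ z, Gn2 z = c) :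
    l1 = m1 ∧ Fn1 = Gn1 := by
  have hder : ∀ z, HasDerivAt (fun z => Fn1 z - Gn1 z) 0 z := by
    intro z
    have h1 := ((hFn1 z).hasDerivAt.cexp).const_mul l1
    have h2 := ((hGn1 z).hasDerivAt.cexp).const_mul m1
    have e : (fun z => l1 * Complex.exp (Fn1 z)) = fun z => m1 * Complex.exp (Gn1 z) := by
      funext y
      rw [← hF1, ← hG1, heq]
    rw [e] at h1
    have h3 := h1.unique h2
    have e' := congrFun e z
    have h4 : (l1 * Complex.exp (Fn1 z)) * (deriv Fn1 z - deriv Gn1 z) = 0 := by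
      linear_combination h3 - deriv Gn1 z * e'
    have h5 := (mul_eq_zero.1 h4).resolve_left (mul_ne_zero hl1 (Complex.exp_ne_zero _))
    have h6 := (hFn1 z).hasDerivAt.sub (hGn1 z).hasDerivAt
    rw [h5] at h6
    exact h6
  have hconst := fun z => is_const_of_deriv_eq_zero (fun z => (hder z).differentiableAt)
    (fun z => (hder z).deriv) z 0
  obtain ⟨C, hC⟩ : ∃ C, C = Fn1 0 - Gn1 0 := ⟨_, rfl⟩
  simp only [← hC] at hconst
  by_cases hC0 : C = 0
  · have hE : Fn1 = Gn1 := by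
      funext z
      exact sub_eq_zero.1 ((hconst z).trans hC0)
    refine ⟨?_, hE⟩
    have h1 := hF1 0
    rw [heq, hG1, hE] at h1
    exact (mul_right_cancel₀ (Complex.exp_ne_zero _) h1).symm
  · exfalso
    have hpi : (2 * Real.pi * Complex.I : ℂ) ≠ 0 := Complex.two_pi_I_ne_zero
    have hF : ∀ z, Fn1 z / C = Complex.exp (Fn2 z + Complex.log (l2 / C)) := by
      intro z
      rw [Complex.exp_add, Complex.exp_log (div_ne_zero hl2 hC0), hF2]
      ring
    obtain ⟨c, hc⟩ := aux_picard
      (fun z => (Fn2 z + Complex.log (l2 / C)) / (2 * Real.pi * Complex.I))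
      (by fun_prop) (by
        intro z k hk
        rw [div_eq_iff hpi] at hk
        have h1 := hF z
        rw [hk, Complex.exp_int_mul_two_pi_mul_I, div_eq_one_iff_eq hC0] at h1
        have h2 := hconst z
        have h3 : Gn1 z = 0 := by linear_combination h1 - h2
        rw [hG2] at h3
        exact mul_ne_zero hm2 (Complex.exp_ne_zero _) h3)
    refine hncFn2 ⟨c * (2 * Real.pi * Complex.I) - Complex.log (l2 / C), fun z => ?_⟩
    have := hc z
    rw [div_eq_iff hpi] at this
    linear_combination this
end

section
/- If f and g are entire functions with g = h ∘ f for entire h, and a ∈ ℂ is an asymptotic value of f, then h(a) is an asymptotic value of g. Moreover, every asymptotic value of h is an asymptotic value of g = h ∘ f. -/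
open Filter

/-- `w` is an asymptotic value of `f`: there is a path tending to infinity along which
`f` tends to `w`. -/
def AsymptoticValue (f : ℂ → ℂ) (w : ℂ) : Prop :=
  ∃ γ : ℝ → ℂ, Continuous γ ∧
    Tendsto (fun t => ‖γ t‖) atTop atTop ∧
    Tendsto (fun t => f (γ t)) atTop (nhds w)

theorem aux_max (f : ℂ → ℂ) (hf : Differentiable ℂ f) (V : Set ℂ) (hV : IsOpen V)
    (a c : ℂ) (s r ρ : ℝ) (hs : 0 < s) (hr : 0 < r) (hρ : 0 < ρ)
    (ha : ∀ z ∈ closure V, s ≤ ‖z - a‖) (hc : ∀ z ∈ closure V, ρ ≤ ‖f z - c‖)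
    (hb : ∀ z ∈ frontier V, ‖f z - c‖ = r) (z : ℂ) (hz : z ∈ V) : r ≤ ‖f z - c‖ := by
  have hzc := subset_closure hz
  have hza := ha z hzc
  have hfz := hc z hzc
  have key : ∀ n : ℕ, (r / ‖f z - c‖) ^ n ≤ ‖z - a‖ / s := by
    intro n
    have h1 : ∀ R : ℝ, ‖z - a‖ < R →
        (1 / ‖f z - c‖) ^ n * (s / ‖z - a‖) ≤ max ((1 / r) ^ n) ((1 / ρ) ^ n * (s / R)) := by
      intro R hR
      have hR0 : 0 < R := by linarith
      set U := V ∩ Metric.ball a R with hU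
      have hUV : closure U ⊆ closure V := closure_mono Set.inter_subset_left
      have hd : DiffContOnCl ℂ (fun z => (1 / (f z - c)) ^ n * ((s : ℂ) / (z - a))) U := by
        apply DifferentiableOn.diffContOnCl
        intro w hw
        have e1 : f w - c ≠ 0 := by
          rw [← norm_pos_iff]; linarith [hc w (hUV hw)]
        have e2 : w - a ≠ 0 := by
          rw [← norm_pos_iff]; linarith [ha w (hUV hw)]
        apply DifferentiableAt.differentiableWithinAt
        have := hf w
        fun_prop (disch := assumption)
      have hn : ∀ w, ‖(1 / (f w - c)) ^ n * ((s : ℂ) / (w - a))‖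
          = (1 / ‖f w - c‖) ^ n * (s / ‖w - a‖) := by
        intro w
        simp [abs_of_pos hs]
      have := Complex.norm_le_of_forall_mem_frontier_norm_le (U := U)
        (Metric.isBounded_ball.subset Set.inter_subset_right) hd
        (C := max ((1 / r) ^ n) ((1 / ρ) ^ n * (s / R))) ?_ (z := z)
        (subset_closure ⟨hz, by simpa [dist_eq_norm] using hR⟩)
      · rwa [hn] at this
      intro w hw
      rw [hn]
      have hwc := hw.1
      have hw1 := ha w (hUV hwc)
      have hw2 := hc w (hUV hwc)
      have hwU : w ∉ U := by
        have := hw.2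
        rwa [(hV.inter Metric.isOpen_ball).interior_eq] at this
      by_cases hwV : w ∈ V
      · have hwR : R ≤ ‖w - a‖ := by
          by_contra hlt
          exact hwU ⟨hwV, by simpa [dist_eq_norm] using hlt⟩
        apply le_max_of_le_right
        gcongr
      · have : w ∈ frontier V := ⟨hUV hwc, by rwa [hV.interior_eq]⟩
        rw [hb w this]
        apply le_max_of_le_left
        have : s / ‖w - a‖ ≤ 1 := by
          rw [div_le_one (by linarith)]; exact hw1
        exact mul_le_of_le_one_right (by positivity) this
    have h2 : (1 / ‖f z - c‖) ^ n * (s / ‖z - a‖) ≤ max ((1 / r) ^ n) ((1 / ρ) ^ n * 0) := by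
      have ht : Tendsto (fun R : ℝ => max ((1 / r) ^ n) ((1 / ρ) ^ n * (s / R))) atTop
          (nhds (max ((1 / r) ^ n) ((1 / ρ) ^ n * 0))) :=
        tendsto_const_nhds.max
          (tendsto_const_nhds.mul (tendsto_const_nhds.div_atTop tendsto_id))
      refine ge_of_tendsto ht ?_
      filter_upwards [eventually_gt_atTop ‖z - a‖] with R hR using h1 R hR
    rw [mul_zero, max_eq_left (by positivity)] at h2
    have p1 : 0 < ‖z - a‖ := by linarith
    have p2 : 0 < ‖f z - c‖ := by linarith
    rw [div_pow, div_le_div_iff₀ (by positivity) hs]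
    rw [div_pow, div_pow, one_pow, div_mul_div_comm,
      div_le_div_iff₀ (by positivity) (by positivity)] at h2
    nlinarith
  by_contra hlt
  push Not at hlt
  have p2 : 0 < ‖f z - c‖ := by linarith
  have : 1 < r / ‖f z - c‖ := by rwa [one_lt_div p2]
  obtain ⟨n, hn⟩ := pow_unbounded_of_one_lt (‖z - a‖ / s) this
  exact absurd (key n) (not_le.mpr hn)

theorem aux_ball (f : ℂ → ℂ) (hf : Differentiable ℂ f) (hnc : ¬ ∃ c : ℂ, ∀ z, f z = c)
    (D E : Set ℂ) (hE : IsOpen E) (hcl : ∀ p ∈ closure E, f p ∈ D → p ∈ E)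
    (c : ℂ) (r : ℝ) (hr : 0 < r) (hB : Metric.ball c r ⊆ D)
    (hne : ∃ z ∈ E, f z ∈ Metric.ball c r) : c ∈ closure (f '' E) := by
  by_contra hcn
  obtain ⟨ρ, hρ, hρb⟩ := Metric.isOpen_iff.1 isClosed_closure.isOpen_compl c hcn
  have hρE : ∀ z ∈ E, ρ ≤ ‖f z - c‖ := by
    intro z hz
    by_contra hlt
    exact hρb (a := f z) (by simpa [dist_eq_norm] using hlt) (subset_closure ⟨z, hz, rfl⟩)
  -- a point far away
  obtain ⟨a, ha⟩ : ∃ a, r < ‖f a - c‖ := by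
    by_contra hcon
    push Not at hcon
    apply hnc
    refine ⟨f 0, fun z => hf.apply_eq_apply_of_bounded ?_ z 0⟩
    refine (Metric.isBounded_closedBall (x := c) (r := r)).subset ?_
    rintro _ ⟨z, rfl⟩
    simpa [dist_eq_norm] using hcon z
  have hO : IsOpen {z | r < ‖f z - c‖} :=
    isOpen_lt continuous_const (hf.continuous.sub continuous_const).norm
  obtain ⟨s, hs, hsb⟩ := Metric.isOpen_iff.1 hO a ha
  have hBo : IsOpen (f ⁻¹' Metric.ball c r) := Metric.isOpen_ball.preimage hf.continuous
  set V := E ∩ f ⁻¹' Metric.ball c r with hV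
  have hVo : IsOpen V := hE.inter hBo
  have hcV : ∀ z ∈ closure V, ‖f z - c‖ ≤ r := by
    have : closure V ⊆ {z | ‖f z - c‖ ≤ r} := by
      apply closure_minimal
      · rintro z ⟨_, hz⟩
        have : ‖f z - c‖ < r := by simpa [dist_eq_norm] using hz
        exact this.le
      · exact isClosed_le (hf.continuous.sub continuous_const).norm continuous_const
    exact this
  obtain ⟨z, hzE, hzB⟩ := hne
  have := aux_max f hf V hVo a c s r ρ hs hr hρ ?_ ?_ ?_ z ⟨hzE, hzB⟩
  · rw [Metric.mem_ball, dist_eq_norm] at hzB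
    linarith
  · intro w hw
    by_contra hlt
    have : r < ‖f w - c‖ := hsb (a := w) (by simpa [dist_eq_norm] using hlt)
    linarith [hcV w hw]
  · have : closure V ⊆ {z | ρ ≤ ‖f z - c‖} := by
      apply closure_minimal
      · rintro z ⟨hz, _⟩
        exact hρE z hz
      · exact isClosed_le continuous_const (hf.continuous.sub continuous_const).norm
    exact this
  · intro w hw
    refine le_antisymm (hcV w hw.1) ?_
    by_contra hlt
    have hwB : f w ∈ Metric.ball c r := by simpa [dist_eq_norm] using hlt
    have hwE : w ∈ E := hcl w (closure_mono Set.inter_subset_left hw.1) (hB hwB)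
    have h2 := hw.2
    rw [hVo.interior_eq] at h2
    exact h2 ⟨hwE, hwB⟩

theorem aux_step (f : ℂ → ℂ) (hf : Differentiable ℂ f) (hnc : ¬ ∃ c : ℂ, ∀ z, f z = c)
    (D D' : Set ℂ) (hD : IsOpen D) (hDc : IsPreconnected D) (hD' : IsOpen D') (hDD : D' ⊆ D)
    (hne : D'.Nonempty) (z : ℂ) (hz : f z ∈ D) :
    ∃ z', f z' ∈ D' ∧ JoinedIn (f ⁻¹' D) z z' := by
  have hpo : IsOpen (f ⁻¹' D) := hD.preimage hf.continuous
  set E := connectedComponentIn (f ⁻¹' D) z with hEdef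
  have hE : IsOpen E := hpo.connectedComponentIn
  have hzE : z ∈ E := mem_connectedComponentIn hz
  have hEs : E ⊆ f ⁻¹' D := connectedComponentIn_subset _ _
  have hEc : IsPreconnected E := isPreconnected_connectedComponentIn
  have hcl : ∀ p ∈ closure E, f p ∈ D → p ∈ E := by
    intro p hp hpD
    have h1 : IsPreconnected (insert p E) :=
      hEc.subset_closure (Set.subset_insert _ _) (Set.insert_subset hp subset_closure)
    exact h1.subset_connectedComponentIn (Set.mem_insert_of_mem _ hzE)
      (Set.insert_subset hpD hEs) (Set.mem_insert _ _)
  have hloc : closure (f '' E) ∩ D ⊆ interior (closure (f '' E)) := by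
    rintro w ⟨hw, hwD⟩
    obtain ⟨s, hs, hsb⟩ := Metric.isOpen_iff.1 hD w hwD
    rw [mem_interior]
    refine ⟨Metric.ball w (s / 4), ?_, Metric.isOpen_ball, Metric.mem_ball_self (by linarith)⟩
    intro c hc
    refine aux_ball f hf hnc D E hE hcl c (s / 2) (by linarith) ?_ ?_
    · refine (Metric.ball_subset_ball' ?_).trans hsb
      rw [Metric.mem_ball] at hc
      linarith
    · obtain ⟨_, ⟨y, hy, rfl⟩, hyd⟩ := Metric.mem_closure_iff.1 hw (s / 4) (by linarith)
      refine ⟨y, hy, ?_⟩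
      rw [Metric.mem_ball] at *
      have := dist_triangle (f y) w c
      rw [dist_comm (f y) w, dist_comm w c] at this
      linarith
  have hsub : D ⊆ interior (closure (f '' E)) := by
    apply hDc.subset_of_closure_inter_subset isOpen_interior
    · exact ⟨f z, hz, hloc ⟨subset_closure ⟨z, hzE, rfl⟩, hz⟩⟩
    · rintro w ⟨hw, hwD⟩
      exact hloc ⟨closure_minimal interior_subset isClosed_closure hw, hwD⟩
  obtain ⟨w, hw⟩ := hne
  obtain ⟨_, hy1, y, hyE, rfl⟩ :=
    mem_closure_iff.1 (interior_subset (hsub (hDD hw))) D' hD' hw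
  refine ⟨y, hy1, ?_⟩
  have hpc : IsPathConnected E := (hE.isConnected_iff_isPathConnected).1 ⟨⟨z, hzE⟩, hEc⟩
  exact (hpc.joinedIn z hzE y hyE).mono hEs

theorem aux_glue (S : ℕ → Set ℂ) (z : ℕ → ℂ) (hj : ∀ n, JoinedIn (S n) (z n) (z (n + 1))) :
    ∃ δ : ℝ → ℂ, Continuous δ ∧ ∀ t, 0 ≤ t → δ t ∈ S ⌊t⌋₊ := by
  choose p hp using hj
  have hlow : ∀ (n : ℕ) (t : ℝ), t ≤ n → (p n).extend (t - n) - z n = 0 := by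
    intro n t ht
    rw [Path.extend_of_le_zero _ (by linarith), sub_self]
  have hhigh : ∀ (n : ℕ) (t : ℝ), n + 1 ≤ t → (p n).extend (t - n) - z n = z (n + 1) - z n := by
    intro n t ht
    rw [Path.extend_of_one_le _ (by linarith)]
  refine ⟨fun t => z 0 + ∑ n ∈ Finset.range (⌊t⌋₊ + 1), ((p n).extend (t - n) - z n), ?_, ?_⟩
  · rw [continuous_iff_continuousAt]
    intro t0
    obtain ⟨N, hN⟩ := exists_nat_gt t0
    have hc : Continuous
        (fun t : ℝ => z 0 + ∑ n ∈ Finset.range (N + 1), ((p n).extend (t - n) - z n)) := by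
      refine continuous_const.add (continuous_finsetSum _ fun n _ => ?_)
      exact ((p n).continuous_extend.comp (continuous_id.sub continuous_const)).sub
        continuous_const
    refine hc.continuousAt.congr ?_
    filter_upwards [eventually_lt_nhds hN] with t ht
    congr 1
    symm
    apply Finset.sum_subset
    · intro n hn
      have : ⌊t⌋₊ ≤ N := Nat.floor_le_of_le ht.le
      simp only [Finset.mem_range] at *
      omega
    · intro n _ hn
      simp only [Finset.mem_range, not_lt] at hn
      apply hlow
      exact (Nat.lt_of_floor_lt (by omega)).le
  · intro t ht
    have h1 : ∑ n ∈ Finset.range ⌊t⌋₊, ((p n).extend (t - n) - z n) = z ⌊t⌋₊ - z 0 := by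
      rw [← Finset.sum_range_sub]
      apply Finset.sum_congr rfl
      intro n hn
      apply hhigh
      have h2 : n + 1 ≤ ⌊t⌋₊ := Finset.mem_range.1 hn
      have h3 := Nat.floor_le ht
      have h4 : ((n + 1 : ℕ) : ℝ) ≤ ⌊t⌋₊ := by exact_mod_cast h2
      push_cast at h4
      linarith
    have h2 : z 0 + ∑ n ∈ Finset.range (⌊t⌋₊ + 1), ((p n).extend (t - n) - z n)
        = (p ⌊t⌋₊).extend (t - ⌊t⌋₊) := by
      rw [Finset.sum_range_succ, h1]; ring
    simp only [h2]
    exact hp _ _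

/-- asymptotic values under composition `g = h ∘ f`. -/
theorem asymptoticValue_comp
    (f h : ℂ → ℂ) (hf : Differentiable ℂ f) (hh : Differentiable ℂ h)
    (hnc : ¬ ∃ c : ℂ, ∀ z, f z = c) :
    (∀ a : ℂ, AsymptoticValue f a → AsymptoticValue (h ∘ f) (h a)) ∧
    (∀ b : ℂ, AsymptoticValue h b → AsymptoticValue (h ∘ f) b) := by
  constructor
  · rintro a ⟨γ, h1, h2, h3⟩
    exact ⟨γ, h1, h2, (hh.continuous.tendsto a).comp h3⟩
  rintro b ⟨γ, h1, h2, h3⟩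
  have hε : ∀ t : ℝ, ∃ ε : ℝ, 0 < ε ∧ ε ≤ 1 ∧
      ∀ z ∈ Metric.ball (γ t) ε, dist (h z) (h (γ t)) < 1 / (|t| + 1) := by
    intro t
    obtain ⟨ε, he, hb⟩ := Metric.continuous_iff.1 hh.continuous (γ t) (1 / (|t| + 1))
      (by positivity)
    exact ⟨min ε 1, lt_min he one_pos, min_le_right _ _,
      fun z hz => hb z (lt_of_lt_of_le hz (min_le_left _ _))⟩
  choose ε hε0 hε1 hεh using hε
  let D : ℕ → Set ℂ := fun n => ⋃ t ∈ Set.Ici (n : ℝ), Metric.ball (γ t) (ε t)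
  have hDo : ∀ n, IsOpen (D n) := fun n => isOpen_biUnion fun _ _ => Metric.isOpen_ball
  have hγD : ∀ n : ℕ, ∀ t : ℝ, (n : ℝ) ≤ t → γ t ∈ D n := fun n t ht =>
    Set.mem_biUnion (show t ∈ Set.Ici (n : ℝ) from ht) (Metric.mem_ball_self (hε0 t))
  have hDc : ∀ n, IsPreconnected (D n) := by
    intro n
    apply isPreconnected_of_forall (γ n)
    intro y hy
    obtain ⟨t, ht, hyt⟩ := Set.mem_iUnion₂.1 hy
    refine ⟨γ '' Set.Ici (n : ℝ) ∪ Metric.ball (γ t) (ε t), ?_, ?_, Or.inr hyt, ?_⟩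
    · apply Set.union_subset
      · rintro _ ⟨u, hu, rfl⟩
        exact hγD n u hu
      · exact Set.subset_biUnion_of_mem (u := fun t => Metric.ball (γ t) (ε t)) ht
    · exact Or.inl ⟨n, Set.self_mem_Ici, rfl⟩
    · exact IsPreconnected.union (γ t) ⟨t, ht, rfl⟩ (Metric.mem_ball_self (hε0 t))
        (isPreconnected_Ici.image _ h1.continuousOn)
        (convex_ball _ _).isPreconnected
  have hDD : ∀ n, D (n + 1) ⊆ D n := by
    intro n
    apply Set.biUnion_subset_biUnion_left
    apply Set.Ici_subset_Ici.2
    push_cast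
    linarith
  obtain ⟨z0, hz0, -⟩ := aux_step f hf hnc Set.univ (D 0) isOpen_univ isPreconnected_univ (hDo 0)
    (Set.subset_univ _) ⟨_, hγD 0 _ le_rfl⟩ 0 trivial
  have hstep : ∀ n z, f z ∈ D n → ∃ z', f z' ∈ D (n + 1) ∧ JoinedIn (f ⁻¹' D n) z z' :=
    fun n z hz => aux_step f hf hnc (D n) (D (n + 1)) (hDo n) (hDc n) (hDo _) (hDD n)
      ⟨_, hγD (n + 1) _ le_rfl⟩ z hz
  choose! nx hnx1 hnx2 using hstep
  let z : ℕ → ℂ := fun n => Nat.rec z0 (fun k w => nx k w) n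
  have hz : ∀ n, f (z n) ∈ D n := by
    intro n
    induction n with
    | zero => exact hz0
    | succ k ih => exact hnx1 k _ ih
  obtain ⟨δ, hδc, hδ⟩ := aux_glue (fun n => f ⁻¹' D n) z (fun n => hnx2 n _ (hz n))
  have hs : ∀ t : ℝ, ∃ s : ℝ, 0 ≤ t → (⌊t⌋₊ : ℝ) ≤ s ∧ f (δ t) ∈ Metric.ball (γ s) (ε s) := by
    intro t
    by_cases ht : 0 ≤ t
    · obtain ⟨s, hs, hm⟩ := Set.mem_iUnion₂.1 (hδ t ht)
      exact ⟨s, fun _ => ⟨hs, hm⟩⟩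
    · exact ⟨0, fun h => absurd h ht⟩
  choose s hs using hs
  have hst : Tendsto s atTop atTop := by
    refine tendsto_atTop_mono' atTop (f₁ := fun t : ℝ => t + (-1)) ?_
      (tendsto_atTop_add_const_right _ _ tendsto_id)
    filter_upwards [eventually_ge_atTop 0] with t ht
    have := (hs t ht).1
    have := Nat.lt_floor_add_one t
    linarith
  have hfδ : Tendsto (fun t => ‖f (δ t)‖) atTop atTop := by
    refine tendsto_atTop_mono' atTop (f₁ := fun t : ℝ => ‖γ (s t)‖ + (-1)) ?_
      (tendsto_atTop_add_const_right _ _ (h2.comp hst))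
    filter_upwards [eventually_ge_atTop 0] with t ht
    have h5 := (hs t ht).2
    rw [Metric.mem_ball, dist_comm, dist_eq_norm] at h5
    have := norm_sub_norm_le (γ (s t)) (f (δ t))
    linarith [hε1 (s t)]
  refine ⟨δ, hδc, ?_, ?_⟩
  · rw [tendsto_atTop]
    intro R
    obtain ⟨M, hM⟩ := (isCompact_closedBall (0 : ℂ) R).exists_bound_of_continuousOn
      hf.continuous.continuousOn
    filter_upwards [hfδ.eventually_gt_atTop M] with t ht
    by_contra hlt
    have := hM (δ t) (by simpa using (not_le.1 hlt).le)
    linarith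
  · have h6 : Tendsto (fun t => h (γ (s t))) atTop (nhds b) := h3.comp hst
    refine (tendsto_iff_of_dist ?_).1 h6
    have h7 : Tendsto (fun t => 1 / (|s t| + 1)) atTop (nhds 0) :=
      tendsto_const_nhds.div_atTop
        (tendsto_atTop_add_const_right _ _ (tendsto_abs_atTop_atTop.comp hst))
    refine squeeze_zero' (Eventually.of_forall fun _ => dist_nonneg) ?_ h7
    filter_upwards [eventually_ge_atTop 0] with t ht
    rw [dist_comm]
    exact (hεh (s t) _ (hs t ht).2).le
end
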